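/- arXiv:1507.00371 — 3 statements merged into one kernel-verified Lean document; each statement's English description precedes it below -/
import Mathlib

section
/- For each j = 1,…,n, the function C_j(x) = x^{μ_j} Σ_{k=0}^{∞} c_{jk} x^{nk}, with c_{jk} = c_{j0}(∏_{s=1}^{k} Δ(μ_j + sn))^{−1}, is n times continuously differentiable on (0,∞) and satisfies the Euler-type equation (3) there: C_j^{(n)}(x) + Σ_{m=0}^{n−2} ν_m x^{m−n} C_j^{(m)}(x) = C_j(x) for all x > 0. -/
def EntC (e : ℕ → ℂ) : Prop := ∀ R : ℝ, 0 ≤ R → Summable fun k => ‖e k‖ * R ^ k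

lemma EntC.mul_lin {e : ℕ → ℂ} (h : EntC e) (b : ℂ) (n : ℕ) :
    EntC fun k => e k * (b + (n : ℂ) * k) := by
  intro R hR
  refine Summable.of_nonneg_of_le (fun k => by positivity) (fun k => ?_)
    ((h (2 * R) (by positivity)).mul_left (‖b‖ + n))
  have h1 : ‖b + (n : ℂ) * k‖ ≤ (‖b‖ + n) * 2 ^ k := by
    have h2 : ((k : ℕ) : ℝ) ≤ 2 ^ k := by exact_mod_cast (Nat.lt_two_pow_self (n := k)).le
    have h3 : (1 : ℝ) ≤ 2 ^ k := one_le_pow₀ (by norm_num)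
    calc ‖b + (n : ℂ) * k‖ ≤ ‖b‖ + ‖(n : ℂ) * k‖ := norm_add_le _ _
      _ = ‖b‖ + n * k := by simp
      _ ≤ ‖b‖ * 2 ^ k + n * 2 ^ k := by
        gcongr
        exact le_mul_of_one_le_right (norm_nonneg _) h3
      _ = _ := by ring
  calc ‖e k * (b + (n : ℂ) * k)‖ * R ^ k = ‖e k‖ * ‖b + (n : ℂ) * k‖ * R ^ k := by rw [norm_mul]
    _ ≤ ‖e k‖ * ((‖b‖ + n) * 2 ^ k) * R ^ k := by gcongr
    _ = _ := by rw [mul_pow]; ring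

lemma EntC.summable {e : ℕ → ℂ} (h : EntC e) (n : ℕ) (x : ℂ) :
    Summable fun k => e k * x ^ (n * k) := by
  refine Summable.of_norm ?_
  refine (h (‖x‖ ^ n) (by positivity)).congr fun k => ?_
  rw [norm_mul, norm_pow, pow_mul]

lemma EntC.hasDerivAt {e : ℕ → ℂ} (h : EntC e) (b : ℂ) (n : ℕ) (x : ℝ) (hx : 0 < x) :
    HasDerivAt (fun x : ℝ => (x : ℂ) ^ b * ∑' k : ℕ, e k * (x : ℂ) ^ (n * k))
      ((x : ℂ) ^ (b - 1) * ∑' k : ℕ, (e k * (b + (n : ℂ) * k)) * (x : ℂ) ^ (n * k)) x := by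
  have hxc : (x : ℂ) ≠ 0 := by exact_mod_cast hx.ne'
  have hs : HasDerivAt (fun z : ℂ => ∑' k : ℕ, e k * z ^ (n * k))
      (∑' k : ℕ, e k * (((n * k : ℕ) : ℂ) * (x : ℂ) ^ (n * k - 1))) (x : ℂ) := by
    have hu : Summable fun k => ‖e k * (0 + (n : ℂ) * k)‖ * ((x + 1) ^ n) ^ k :=
      (h.mul_lin 0 n) _ (by positivity)
    refine hasDerivAt_tsum_of_isPreconnected hu (t := Metric.ball (0 : ℂ) (x + 1))
      (g := fun k z => e k * z ^ (n * k))
      (g' := fun k z => e k * (((n * k : ℕ) : ℂ) * z ^ (n * k - 1)))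
      Metric.isOpen_ball (convex_ball _ _).isPreconnected
      (fun k y _ => (hasDerivAt_pow _ _).const_mul _) (fun k y hy => ?_)
      (y₀ := 0) (by simp; linarith) (h.summable n 0) (by simp [abs_of_pos hx])
    have hy' : ‖y‖ ≤ x + 1 := by simpa using (mem_ball_zero_iff.1 hy).le
    rw [zero_add, ← mul_assoc, norm_mul, ← pow_mul, norm_pow]
    push_cast
    gcongr
    calc ‖y‖ ^ (n * k - 1) ≤ (x + 1) ^ (n * k - 1) := by gcongr
      _ ≤ (x + 1) ^ (n * k) := pow_le_pow_right₀ (by linarith) (by omega)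
  have hp : HasDerivAt (fun z : ℂ => z ^ b) (b * (x : ℂ) ^ (b - 1)) (x : ℂ) := by
    simpa using (hasDerivAt_id (x : ℂ)).cpow_const (c := b) (Or.inl (by simpa using hx))
  have := (hp.mul hs).comp_ofReal
  refine this.congr_deriv ?_
  have e1 : (x : ℂ) ^ b = (x : ℂ) ^ (b - 1) * x := by
    rw [Complex.cpow_sub _ _ hxc, Complex.cpow_one]; field_simp
  have e2 : (x : ℂ) * (∑' k : ℕ, e k * (((n * k : ℕ) : ℂ) * (x : ℂ) ^ (n * k - 1)))
      = ∑' k : ℕ, (e k * (0 + (n : ℂ) * k)) * (x : ℂ) ^ (n * k) := by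
    rw [← tsum_mul_left]
    congr 1; ext k
    rcases Nat.eq_zero_or_pos (n * k) with h0 | h0
    · have : (n : ℂ) * k = 0 := by exact_mod_cast h0
      simp [this]
    · obtain ⟨m, hm⟩ := Nat.exists_eq_succ_of_ne_zero h0.ne'
      have : (n : ℂ) * k = ((n * k : ℕ) : ℂ) := by push_cast; rfl
      rw [this, hm]; simp [pow_succ]; ring
  have e3 : ∑' k : ℕ, (e k * (b + (n : ℂ) * k)) * (x : ℂ) ^ (n * k)
      = b * (∑' k : ℕ, e k * (x : ℂ) ^ (n * k))
        + ∑' k : ℕ, (e k * (0 + (n : ℂ) * k)) * (x : ℂ) ^ (n * k) := by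
    rw [← tsum_mul_left, ← Summable.tsum_add ((h.summable n x).mul_left b)
      ((h.mul_lin 0 n).summable n x)]
    congr 1; ext k; ring
  rw [e3, ← e2, e1]; ring

lemma seq_contDiffOn (f : ℕ → ℝ → ℂ)
    (hf : ∀ m x, 0 < x → HasDerivAt (f m) (f (m + 1) x) x) (N : ℕ) :
    ∀ m, ContDiffOn ℝ N (f m) (Set.Ioi 0) := by
  induction N with
  | zero =>
    intro m
    exact contDiffOn_zero.2 fun x hx => (hf m x hx).continuousAt.continuousWithinAt
  | succ N ih =>
    intro m
    have := (contDiffOn_succ_iff_deriv_of_isOpen (𝕜 := ℝ) (n := (N : WithTop ℕ∞)) (f := f m)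
      (isOpen_Ioi (a := (0 : ℝ)))).2
      ⟨fun x hx => (hf m x hx).differentiableAt.differentiableWithinAt, by simp,
        (ih (m + 1)).congr fun x hx => (hf m x hx).deriv⟩
    exact_mod_cast this

lemma seq_iteratedDeriv (f : ℕ → ℝ → ℂ)
    (hf : ∀ m x, 0 < x → HasDerivAt (f m) (f (m + 1) x) x) (m : ℕ) :
    ∀ x, 0 < x → iteratedDeriv m (f 0) x = f m x := by
  induction m with
  | zero => intro x _; simp
  | succ m ih =>
    intro x hx
    rw [iteratedDeriv_succ]
    have : iteratedDeriv m (f 0) =ᶠ[nhds x] f m := by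
      filter_upwards [isOpen_Ioi.mem_nhds hx] with y hy using ih y hy
    rw [this.deriv_eq, (hf m x hx).deriv]


/-- For each j, the function C_j(x) = x^{μ_j} Σ_{k} c_{jk} x^{nk} is n times
continuously differentiable on (0,∞) and satisfies the Euler-type equation (3) there:
C_j^{(n)}(x) + Σ_{m=0}^{n−2} ν_m x^{m−n} C_j^{(m)}(x) = C_j(x) for all x > 0. -/
theorem stmt2 (n : ℕ) (hn : 2 ≤ n) (v : ℕ → ℂ) (hvn : v n = 1) (hvn1 : v (n - 1) = 0)
    (Δ : ℂ → ℂ)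
    (hΔ : ∀ z, Δ z = ∑ j ∈ Finset.range (n + 1), v j * ∏ k ∈ Finset.range j, (z - (k : ℂ)))
    (μ : Fin n → ℂ)
    (hroots : ∀ z, Δ z = ∏ j, (z - μ j))
    (hsep : ∀ j k, j ≠ k → ∀ s : ℤ, μ j - μ k ≠ (s : ℂ) * (n : ℂ))
    (hre : StrictMono fun j => (μ j).re)
    (c0 : Fin n → ℂ) (hc0 : ∀ j, c0 j ≠ 0)
    (c : Fin n → ℕ → ℂ)
    (hc : ∀ j k, c j k = c0 j * (∏ s ∈ Finset.Icc 1 k, Δ (μ j + (s : ℂ) * (n : ℂ)))⁻¹)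
    (C : Fin n → ℝ → ℂ)
    (hC : ∀ j x, C j x = (x : ℂ) ^ (μ j) * ∑' k : ℕ, c j k * (x : ℂ) ^ (n * k)) :
    ∀ j : Fin n,
      ContDiffOn ℝ n (C j) (Set.Ioi 0) ∧
      ∀ x : ℝ, 0 < x →
        iteratedDeriv n (C j) x
          + ∑ m ∈ Finset.range (n - 1),
              v m * (x : ℂ) ^ ((m : ℂ) - (n : ℂ)) * iteratedDeriv m (C j) x
        = C j x := by
  intro j
  have hn0 : (n : ℂ) ≠ 0 := by exact_mod_cast (by omega : n ≠ 0)
  have hΔ0 : ∀ s : ℕ, Δ (μ j + ((s + 1 : ℕ) : ℂ) * n) ≠ 0 := by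
    intro s
    rw [hroots, Finset.prod_ne_zero_iff]
    intro i _ h0
    by_cases hij : j = i
    · subst hij
      have : ((s + 1 : ℕ) : ℂ) * n = 0 := by linear_combination h0
      rcases mul_eq_zero.1 this with h | h
      · exact Nat.succ_ne_zero s (by exact_mod_cast h)
      · exact hn0 h
    · refine hsep j i hij (-(s + 1 : ℕ)) ?_
      push_cast at h0 ⊢
      linear_combination h0
  have hΔμ : Δ (μ j) = 0 := by
    rw [hroots]; exact Finset.prod_eq_zero (Finset.mem_univ j) (sub_self _)
  have hcs : ∀ k, c j (k + 1) * Δ (μ j + ((k + 1 : ℕ) : ℂ) * n) = c j k := by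
    intro k
    rw [hc, hc, Finset.prod_Icc_succ_top (by omega), mul_inv, mul_assoc, mul_assoc,
      inv_mul_cancel₀ (hΔ0 k), mul_one]
  have hcne : ∀ k, c j k ≠ 0 := by
    intro k
    induction k with
    | zero => rw [hc]; simpa using hc0 j
    | succ k ih => intro h; apply ih; rw [← hcs, h, zero_mul]
  have htop : Filter.Tendsto (fun k : ℕ => ‖Δ (μ j + ((k + 1 : ℕ) : ℂ) * n)‖)
      Filter.atTop Filter.atTop := by
    have hz : Filter.Tendsto (fun k : ℕ => ‖μ j + ((k + 1 : ℕ) : ℂ) * n‖)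
        Filter.atTop Filter.atTop := by
      refine Filter.tendsto_atTop_mono (f := fun k : ℕ => -‖μ j‖ + (k : ℝ)) (fun k => ?_)
        (Filter.tendsto_atTop_add_const_left _ _ tendsto_natCast_atTop_atTop)
      have h1 : ‖((k + 1 : ℕ) : ℂ) * n‖ ≤ ‖μ j + ((k + 1 : ℕ) : ℂ) * n‖ + ‖μ j‖ := by
        have := norm_sub_le (μ j + ((k + 1 : ℕ) : ℂ) * n) (μ j)
        rwa [add_sub_cancel_left] at this
      have h2 : (k : ℝ) ≤ ‖((k + 1 : ℕ) : ℂ) * n‖ := by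
        rw [norm_mul, Complex.norm_natCast, Complex.norm_natCast]
        have : k ≤ (k + 1) * n := by nlinarith
        exact_mod_cast this
      linarith
    have := Polynomial.tendsto_norm_atTop (∏ i, (Polynomial.X - Polynomial.C (μ i)))
      (by
        rw [Polynomial.degree_prod]
        simp
        omega) hz
    refine this.congr fun k => ?_
    rw [hroots, Polynomial.eval_prod]
    simp
  have hE : EntC (c j) := by
    intro R hR
    rcases hR.eq_or_lt with rfl | hR
    · refine summable_of_ne_finset_zero (s := {0}) fun k hk => ?_
      simp at hk
      simp [hk]
    refine summable_of_ratio_test_tendsto_lt_one (l := 0) one_pos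
      (Filter.Eventually.of_forall fun k => ?_) ?_
    · have := hcne k
      positivity
    · have := htop.const_div_atTop R
      refine this.congr fun k => ?_
      have h1 := hcne (k + 1)
      have h2 := hΔ0 k
      rw [← hcs k]
      simp only [norm_mul, norm_norm, norm_pow, Real.norm_of_nonneg hR.le, pow_succ]
      have h1 := norm_ne_zero_iff.2 h1
      have h2 := norm_ne_zero_iff.2 h2
      field_simp
  set e : ℕ → ℕ → ℂ := fun m k => c j k * ∏ i ∈ Finset.range m, (μ j + n * k - (i : ℂ)) with he
  have hes : ∀ m, e (m + 1) = fun k => e m k * ((μ j - m) + (n : ℂ) * k) := by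
    intro m
    ext k
    simp only [he, Finset.prod_range_succ]
    ring
  have heE : ∀ m, EntC (e m) := by
    intro m
    induction m with
    | zero => simpa [he] using hE
    | succ m ih => rw [hes]; exact ih.mul_lin _ _
  set f : ℕ → ℝ → ℂ := fun m x => (x : ℂ) ^ (μ j - m) * ∑' k : ℕ, e m k * (x : ℂ) ^ (n * k) with hf
  have hfd : ∀ m x, 0 < x → HasDerivAt (f m) (f (m + 1) x) x := by
    intro m x hx
    have := (heE m).hasDerivAt (μ j - m) n x hx
    rw [sub_sub] at this
    simp only [hf, hes]
    exact_mod_cast this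
  have hCf : C j = f 0 := by
    ext x
    rw [hC]
    simp [hf, he]
  rw [hCf]
  refine ⟨seq_contDiffOn f hfd n 0, fun x hx => ?_⟩
  have hxc : (x : ℂ) ≠ 0 := by exact_mod_cast hx.ne'
  simp only [seq_iteratedDeriv f hfd _ x hx]
  have hterm : ∀ m : ℕ, v m * (x : ℂ) ^ ((m : ℂ) - n) * f m x
      = (x : ℂ) ^ (μ j - n) * ∑' k : ℕ, v m * (e m k * (x : ℂ) ^ (n * k)) := by
    intro m
    have : (x : ℂ) ^ (μ j - n) = (x : ℂ) ^ ((m : ℂ) - n) * (x : ℂ) ^ (μ j - m) := by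
      rw [← Complex.cpow_add _ _ hxc]; ring_nf
    rw [this, tsum_mul_left]
    simp only [hf]
    ring
  have hsum : f n x + ∑ m ∈ Finset.range (n - 1), v m * (x : ℂ) ^ ((m : ℂ) - n) * f m x
      = ∑ m ∈ Finset.range (n + 1), v m * (x : ℂ) ^ ((m : ℂ) - n) * f m x := by
    obtain ⟨p, rfl⟩ : ∃ p, n = p + 1 := ⟨n - 1, by omega⟩
    rw [Finset.sum_range_succ, hvn]
    simp only [Nat.add_sub_cancel] at hvn1 ⊢
    rw [Finset.sum_range_succ, hvn1]
    simp
    ring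
  rw [hsum, Finset.sum_congr rfl fun m _ => hterm m, ← Finset.mul_sum,
    ← Summable.tsum_finsetSum fun m _ => ((heE m).summable n x).mul_left (v m)]
  have hk : ∀ k : ℕ, ∑ m ∈ Finset.range (n + 1), v m * (e m k * (x : ℂ) ^ (n * k))
      = c j k * Δ (μ j + (k : ℂ) * n) * (x : ℂ) ^ (n * k) := by
    intro k
    rw [hΔ, Finset.mul_sum, Finset.sum_mul]
    refine Finset.sum_congr rfl fun m _ => ?_
    simp only [he, mul_comm (n : ℂ) (k : ℂ)]
    ring
  have hS : Summable fun k : ℕ => c j k * Δ (μ j + (k : ℂ) * n) * (x : ℂ) ^ (n * k) := by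
    simp only [← hk]
    exact summable_sum fun m _ => ((heE m).summable n x).mul_left (v m)
  simp only [hk]
  rw [hS.tsum_eq_zero_add]
  simp only [hcs]
  rw [← hCf, hC, Complex.cpow_sub _ _ hxc, Complex.cpow_natCast]
  have : ∀ k : ℕ, c j k * (x : ℂ) ^ (n * (k + 1)) = (x : ℂ) ^ n * (c j k * (x : ℂ) ^ (n * k)) := by
    intro k; rw [mul_add, pow_add]; ring
  simp only [this, tsum_mul_left]
  simp [hΔμ]
  field_simp
end

section
/- (Lemma 2) Suppose e_1,…,e_n are holomorphic functions on the cut plane Π_− such that: (i) e_{s+1}(x) = e_1(ε^{s} x) whenever arg x ∈ (−π, π − 2πs/n), where ε = exp(2πi/n); (ii) each e_k has an expansion e_k(x) = Σ_{j=1}^{n} β_{kj}^0 C_j(x) with constants β_{kj}^0, where the C_j satisfy C_j(εx) = exp(2πiμ_j/n) C_j(x) for arg x ∈ (−π, π − 2π/n) and det[C_j^{(ν−1)}(x)]_{j,ν=1,…,n} = 1; (iii) det[e_k^{(ν−1)}(x)]_{k,ν=1,…,n} = det[ε_k^{ν−1}]_{k,ν=1,…,n}. Then β_{kj}^0 = β_{1j}^0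 ε_k^{μ_j} for all j,k = 1,…,n, where ε_k^{μ_j} := exp(2πi(k−1)μ_j/n), and ∏_{j=1}^{n} β_{1j}^0 = (det[ε_k^{μ_j}]_{k,j=1,…,n})^{−1} det[ε_k^{j−1}]_{k,j=1,…,n} ≠ 0. -/
lemma aux_arg_eps (n : ℕ) (hn : 2 ≤ n) :
    (Complex.exp (2 * Real.pi * Complex.I / n)).arg = 2 * Real.pi / n := by
  have hn' : (2:ℝ) ≤ n := by exact_mod_cast hn
  have hpi := Real.pi_pos
  have h : (2 * Real.pi * Complex.I / n : ℂ) = ((2 * Real.pi / n : ℝ) : ℂ) * Complex.I := by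
    push_cast; ring
  rw [h, Complex.arg_exp_mul_I, toIocMod_eq_self]
  constructor
  · have : 0 < 2 * Real.pi / n := by positivity
    linarith
  · have : 2 * Real.pi / n ≤ Real.pi := by
      rw [div_le_iff₀ (by linarith)]; nlinarith
    linarith

lemma aux_arg_pow (n : ℕ) (hn : 2 ≤ n) (x : ℂ) (hx : x ≠ 0) (t : ℕ)
    (h : x.arg + 2 * Real.pi * t / n < Real.pi) :
    (Complex.exp (2 * Real.pi * Complex.I / n) ^ t * x).arg = x.arg + 2 * Real.pi * t / n := by
  induction t with
  | zero => simp
  | succ t ih =>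
    have hn' : (2:ℝ) ≤ n := by exact_mod_cast hn
    have hpi := Real.pi_pos
    have h0 : 0 < 2 * Real.pi / n := by positivity
    have h1 : 2 * Real.pi * ((t + 1 : ℕ) : ℝ) / n = 2 * Real.pi * t / n + 2 * Real.pi / n := by
      push_cast; ring
    rw [h1] at h
    have ih' := ih (by linarith)
    have h2 : 0 ≤ 2 * Real.pi * t / n := by positivity
    have h3 := Complex.neg_pi_lt_arg x
    rw [pow_succ', mul_assoc, Complex.arg_mul (Complex.exp_ne_zero _)
      (mul_ne_zero (pow_ne_zero _ (Complex.exp_ne_zero _)) hx), aux_arg_eps n hn, ih', h1]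
    · ring
    · rw [aux_arg_eps n hn, ih']
      constructor <;> linarith

lemma aux_mon (n : ℕ) (hn : 2 ≤ n) (m : ℂ) (C : ℂ → ℂ)
    (hCmon : ∀ x : ℂ, x ≠ 0 →
      x.arg ∈ Set.Ioo (-Real.pi) (Real.pi - 2 * Real.pi / n) →
      C (Complex.exp (2 * Real.pi * Complex.I / n) * x)
        = Complex.exp (2 * Real.pi * Complex.I * m / n) * C x)
    (x : ℂ) (hx : x ≠ 0) (h0 : -Real.pi < x.arg) (t : ℕ)
    (h : x.arg + 2 * Real.pi * t / n < Real.pi) :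
    C (Complex.exp (2 * Real.pi * Complex.I / n) ^ t * x)
      = Complex.exp (2 * Real.pi * Complex.I * t * m / n) * C x := by
  induction t with
  | zero => simp
  | succ t ih =>
    have hn' : (2:ℝ) ≤ n := by exact_mod_cast hn
    have hpi := Real.pi_pos
    have h1 : 2 * Real.pi * ((t + 1 : ℕ) : ℝ) / n = 2 * Real.pi * t / n + 2 * Real.pi / n := by
      push_cast; ring
    rw [h1] at h
    have h00 : 0 < 2 * Real.pi / n := by positivity
    have h2 : 0 ≤ 2 * Real.pi * t / n := by positivity
    have h3 := aux_arg_pow n hn x hx t (by linarith)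
    rw [pow_succ', mul_assoc, hCmon _ (mul_ne_zero (pow_ne_zero _ (Complex.exp_ne_zero _)) hx)
      (by rw [h3]; constructor <;> linarith), ih (by linarith), ← mul_assoc, ← Complex.exp_add]
    congr 2
    push_cast; ring

lemma aux_iter (n : ℕ) (C : Fin n → ℂ → ℂ) (b : Fin n → ℂ) (x : ℂ)
    (hC : ∀ j, AnalyticAt ℂ (C j) x) (f : ℂ → ℂ)
    (hf : f =ᶠ[nhds x] fun z => ∑ j, b j * C j z) (i : ℕ) :
    iteratedDeriv i f x = ∑ j, b j * iteratedDeriv i (C j) x := by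
  rw [hf.iteratedDeriv_eq, iteratedDeriv_fun_sum]
  · refine Finset.sum_congr rfl fun j _ => ?_
    rw [iteratedDeriv_const_mul_field]
  · intro j _
    exact (contDiffAt_const.mul (hC j).contDiffAt)


/-- Lemma 2: If e_1,…,e_n are holomorphic on the cut plane Π_− with
e_{s+1}(x) = e_1(ε^s x) for arg x ∈ (−π, π − 2πs/n), e_k = Σ_j β_{kj}^0 C_j where
C_j(εx) = exp(2πiμ_j/n)C_j(x) and det[C_j^{(ν−1)}] = 1, and
det[e_k^{(ν−1)}(x)] = det[ε_k^{ν−1}], then β_{kj}^0 = β_{1j}^0 ε_k^{μ_j} and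
∏_j β_{1j}^0 = (det[ε_k^{μ_j}])⁻¹ det[ε_k^{j−1}] ≠ 0. -/
theorem stmt6 (n : ℕ) (hn : 2 ≤ n) (v : ℕ → ℂ) (hvn : v n = 1) (hvn1 : v (n - 1) = 0)
    (μ : Fin n → ℂ)
    (hsep : ∀ j k, j ≠ k → ∀ s : ℤ, μ j - μ k ≠ (s : ℂ) * (n : ℂ))
    (hre : StrictMono fun j => (μ j).re)
    (Pm : Set ℂ) (hPm : Pm = {z : ℂ | ¬ (z.im = 0 ∧ z.re ≤ 0)})
    (ε : Fin n → ℂ) (hε : ∀ k, ε k = Complex.exp (2 * Real.pi * Complex.I * (k : ℕ) / n))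
    (C : Fin n → ℂ → ℂ)
    (hChol : ∀ j, DifferentiableOn ℂ (C j) Pm)
    -- C_j form a fundamental system of solutions of (3) with Wronskian 1
    (hCsol : ∀ j, ∀ x ∈ Pm,
      iteratedDeriv n (C j) x
        + ∑ m ∈ Finset.range (n - 1),
            v m * x ^ ((m : ℂ) - (n : ℂ)) * iteratedDeriv m (C j) x
      = C j x)
    (hCdet : ∀ x ∈ Pm,
      Matrix.det (Matrix.of fun j i : Fin n => iteratedDeriv (i : ℕ) (C j) x) = 1)
    -- the monodromy relation for C_j
    (hCmon : ∀ j : Fin n, ∀ x : ℂ, x ≠ 0 →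
      x.arg ∈ Set.Ioo (-Real.pi) (Real.pi - 2 * Real.pi / n) →
      C j (Complex.exp (2 * Real.pi * Complex.I / n) * x)
        = Complex.exp (2 * Real.pi * Complex.I * μ j / n) * C j x)
    (e : Fin n → ℂ → ℂ)
    (hehol : ∀ k, DifferentiableOn ℂ (e k) Pm)
    -- (i): e_{s+1}(x) = e_1(ε^s x) for arg x ∈ (−π, π − 2πs/n)
    (hshift : ∀ s : Fin n, ∀ x : ℂ, x ≠ 0 →
      x.arg ∈ Set.Ioo (-Real.pi) (Real.pi - 2 * Real.pi * (s : ℕ) / n) →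
      e s x = e ⟨0, by omega⟩ (Complex.exp (2 * Real.pi * Complex.I / n) ^ (s : ℕ) * x))
    -- (ii): expansions in the basis C_j
    (β : Fin n → Fin n → ℂ)
    (hexp : ∀ k : Fin n, ∀ x ∈ Pm, e k x = ∑ j, β k j * C j x)
    -- (iii): the Wronskian of the e_k
    (hedet : ∀ x ∈ Pm,
      Matrix.det (Matrix.of fun k i : Fin n => iteratedDeriv (i : ℕ) (e k) x)
        = Matrix.det (Matrix.of fun k i : Fin n => ε k ^ (i : ℕ))) :
    (∀ j k : Fin n,
      β k j = β ⟨0, by omega⟩ j * Complex.exp (2 * Real.pi * Complex.I * (k : ℕ) * μ j / n)) ∧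
    (∏ j, β ⟨0, by omega⟩ j
      = (Matrix.det (Matrix.of fun k j : Fin n =>
            Complex.exp (2 * Real.pi * Complex.I * (k : ℕ) * μ j / n)))⁻¹
        * Matrix.det (Matrix.of fun k j : Fin n => ε k ^ (j : ℕ))) ∧
    (∏ j, β ⟨0, by omega⟩ j) ≠ 0 := by
  have hPm' : Pm = Complex.slitPlane := by
    rw [hPm]; ext z
    simp only [Set.mem_setOf_eq, Complex.mem_slitPlane_iff]
    by_cases h : z.im = 0 <;> simp [h]
  clear hPm
  subst hPm'
  have hopen := Complex.isOpen_slitPlane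
  have hn' : (2:ℝ) ≤ n := by exact_mod_cast hn
  have hpi := Real.pi_pos
  have hCan : ∀ j, ∀ x ∈ Complex.slitPlane, AnalyticAt ℂ (C j) x := fun j x hx =>
    (hChol j).analyticAt (hopen.mem_nhds hx)
  have key : ∀ j k : Fin n,
      β k j = β ⟨0, by omega⟩ j
        * Complex.exp (2 * Real.pi * Complex.I * (k : ℕ) * μ j / n) := by
    intro j k
    have hk : ((k : ℕ) : ℝ) < n := by exact_mod_cast k.2
    have hk1 : ((k : ℕ) : ℝ) / n < 1 := by rw [div_lt_one (by linarith)]; exact hk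
    have hk0 : 0 ≤ ((k : ℕ) : ℝ) / n := by positivity
    obtain ⟨x0, hx0⟩ : ∃ x0 : ℂ, x0 = Complex.exp (((-(Real.pi * ((k : ℕ) / n)) : ℝ) : ℂ)
      * Complex.I) := ⟨_, rfl⟩
    have harg : x0.arg = -(Real.pi * ((k : ℕ) / n)) := by
      rw [hx0, Complex.arg_exp_mul_I, toIocMod_eq_self]
      constructor <;> nlinarith
    have hx0ne : x0 ≠ 0 := by rw [hx0]; exact Complex.exp_ne_zero _
    have hx0s : x0 ∈ Complex.slitPlane := by
      rw [Complex.mem_slitPlane_iff_arg]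
      refine ⟨?_, hx0ne⟩
      rw [harg]; nlinarith
    have h2k : 2 * Real.pi * ((k : ℕ) : ℝ) / n = 2 * (Real.pi * ((k : ℕ) / n)) := by ring
    have hev : ∀ᶠ z in nhds x0, z ∈ Complex.slitPlane ∧
        z.arg ∈ Set.Ioo (-Real.pi) (Real.pi - 2 * Real.pi * ((k : ℕ) : ℝ) / n) := by
      refine Filter.Eventually.and (hopen.mem_nhds hx0s) ?_
      refine (Complex.continuousAt_arg hx0s).eventually (isOpen_Ioo.mem_nhds ?_)
      rw [harg, h2k]
      constructor <;> nlinarith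
    have hz : (fun _ : ℂ => (0:ℂ)) =ᶠ[nhds x0] fun z => ∑ j, (β k j - β ⟨0, by omega⟩ j
        * Complex.exp (2 * Real.pi * Complex.I * (k : ℕ) * μ j / n)) * C j z := by
      filter_upwards [hev] with z hz
      obtain ⟨hzs, hza⟩ := hz
      have hz0 : z ≠ 0 := Complex.slitPlane_ne_zero hzs
      have hlt : z.arg + 2 * Real.pi * ((k : ℕ) : ℝ) / n < Real.pi := by linarith [hza.2]
      have hzk := aux_arg_pow n hn z hz0 k hlt
      have h1 := hshift k z hz0 hza
      rw [hexp k z hzs, hexp _ _ (by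
        rw [Complex.mem_slitPlane_iff_arg]
        exact ⟨by rw [hzk]; exact hlt.ne,
          mul_ne_zero (pow_ne_zero _ (Complex.exp_ne_zero _)) hz0⟩)] at h1
      symm
      simp only [sub_mul, Finset.sum_sub_distrib]
      rw [sub_eq_zero, h1]
      refine Finset.sum_congr rfl fun j _ => ?_
      rw [aux_mon n hn (μ j) (C j) (hCmon j) z hz0 hza.1 k hlt]; ring
    have hv : Matrix.vecMul (fun j => β k j - β ⟨0, by omega⟩ j
        * Complex.exp (2 * Real.pi * Complex.I * (k : ℕ) * μ j / n))
        (Matrix.of fun j i : Fin n => iteratedDeriv (i : ℕ) (C j) x0) = 0 := by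
      ext i
      have := aux_iter n C _ x0 (fun j => hCan j x0 hx0s) _ hz i
      simp only [Matrix.vecMul, dotProduct, Matrix.of_apply, Pi.zero_apply]
      rw [← this]
      simp [iteratedDeriv_const]
    have h0 := Matrix.eq_zero_of_vecMul_eq_zero (by rw [hCdet x0 hx0s]; exact one_ne_zero) hv
    exact sub_eq_zero.1 (congrFun h0 j)
  have h1s : (1:ℂ) ∈ Complex.slitPlane := Complex.one_mem_slitPlane
  have hW : (Matrix.of fun k i : Fin n => iteratedDeriv (i : ℕ) (e k) 1)
      = Matrix.of β * Matrix.of fun j i : Fin n => iteratedDeriv (i : ℕ) (C j) 1 := by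
    ext k i
    rw [Matrix.mul_apply]
    simp only [Matrix.of_apply]
    exact aux_iter n C (β k) 1 (fun j => hCan j 1 h1s) (e k)
      (Filter.eventuallyEq_of_mem (hopen.mem_nhds h1s) (hexp k)) i
  have hB : Matrix.of β = (Matrix.of fun k j : Fin n =>
      Complex.exp (2 * Real.pi * Complex.I * (k : ℕ) * μ j / n))
        * Matrix.diagonal (β ⟨0, by omega⟩) := by
    ext k j
    rw [Matrix.mul_diagonal]
    simp only [Matrix.of_apply]
    rw [key j k, mul_comm]
  have hdet := hedet 1 h1s
  rw [hW, Matrix.det_mul, hCdet 1 h1s, mul_one, hB, Matrix.det_mul, Matrix.det_diagonal] at hdet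
  have hne : Matrix.det (Matrix.of fun k i : Fin n => ε k ^ (i : ℕ)) ≠ 0 := by
    refine (Matrix.det_vandermonde_ne_zero_iff (v := ε)).2 ?_
    intro a b hab
    have hp := Complex.isPrimitiveRoot_exp n (by omega)
    have hεp : ∀ k : Fin n, ε k = Complex.exp (2 * Real.pi * Complex.I / n) ^ (k : ℕ) := by
      intro k
      rw [hε, ← Complex.exp_nat_mul]
      congr 1; ring
    rw [hεp, hεp] at hab
    exact Fin.ext (hp.pow_inj a.2 b.2 hab)
  rw [← hdet] at hne
  refine ⟨key, ?_, right_ne_zero_of_mul hne⟩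
  rw [← hdet, inv_mul_cancel_left₀ (left_ne_zero_of_mul hne)]
end

section
/- (Lemma 4) Let μ_1,…,μ_n ∈ ℂ with Re μ_1 < … < Re μ_n, let ρ ≠ 0, let c_{10},…,c_{n0} be nonzero, and let Ŝ_j, Ĉ_j : [0,X] → ℂ be continuous with Ŝ_j(0) = Ĉ_j(0) = c_{j0} and Ŝ_j(x) − Ĉ_j(x) = o(x^{Re(μ_n−μ_1)}) as x → 0+. Given constants b_{kj}(ρ) and b^0_{kj}, define U_{k0}(x,ρ) = Σ_{j=1}^{n} b_{kj}(ρ) ρ^{−μ_1} x^{μ_j−μ_1} Ŝ_j(x), U^0_{k0}(x,ρ) = Σ_{j=1}^{n} b^0_{kj} (ρx)^{μ_j−μ_1} Ĉ_j(x), and recursively F_{k1}(x,ρ) = U_{k0}(x,ρ) − U^0_{k0}(x,ρ), F_{k,s+1}(x,ρ) = (F_{ks}(x,ρ) − F_{ks}(0,ρ) Ŝ_s(x) c_{s0}^{−1}) x^{μ_s−μ_{s+1}}, where F_{ks}(0,ρ) := lim_{x→0+} F_{ks}(x,ρ). Then for each s = 1,…,n these limits exist and F_{ks}(0,ρ) =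 (b_{ks}(ρ)ρ^{−μ_1} − b^0_{ks} ρ^{μ_s−μ_1}) c_{s0}, and moreover F_{ks}(x,ρ) = ( (U_{k0}(x,ρ) − U^0_{k0}(x,ρ)) − Σ_{j=1}^{s−1} (b_{kj}(ρ)ρ^{−μ_1} − b^0_{kj} ρ^{μ_j−μ_1}) x^{μ_j−μ_1} Ŝ_j(x) ) x^{μ_1−μ_s} for x ∈ (0,X]. -/
open Asymptotics Filter

lemma aux_mul_cpow (ρ : ℂ) (hρ : ρ ≠ 0) (x : ℝ) (hx : 0 < x) (p : ℂ) :
    (ρ * (x : ℂ)) ^ p = ρ ^ p * (x : ℂ) ^ p := by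
  have hx' : (x : ℂ) ≠ 0 := by exact_mod_cast hx.ne'
  rw [Complex.cpow_def_of_ne_zero (mul_ne_zero hρ hx'), Complex.cpow_def_of_ne_zero hρ,
    Complex.cpow_def_of_ne_zero hx', Complex.log_mul_ofReal x hx ρ hρ, ← Complex.exp_add,
    Complex.ofReal_log hx.le]
  ring_nf

lemma aux_pow_zero (p : ℂ) (hp : 0 < p.re) :
    Tendsto (fun x : ℝ => (x : ℂ) ^ p) (nhdsWithin 0 (Set.Ioi 0)) (nhds 0) := by
  have h := (Complex.continuousAt_ofReal_cpow_const 0 p (Or.inl hp)).tendsto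
  have hp0 : p ≠ 0 := by
    rintro rfl
    simp at hp
  simp only [Complex.ofReal_zero, Complex.zero_cpow hp0] at h
  exact h.mono_left nhdsWithin_le_nhds

lemma aux_little (f : ℝ → ℂ) (r : ℝ) (p : ℂ) (hp : 0 ≤ p.re + r)
    (hf : f =o[nhdsWithin 0 (Set.Ioi 0)] fun x : ℝ => x ^ r) :
    Tendsto (fun x : ℝ => (x : ℂ) ^ p * f x) (nhdsWithin 0 (Set.Ioi 0)) (nhds 0) := by
  have h1 : (fun x : ℝ => (x : ℂ) ^ p * f x) =o[nhdsWithin 0 (Set.Ioi 0)]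
      fun x : ℝ => (x : ℂ) ^ p * ((x ^ r : ℝ) : ℂ) :=
    (isBigO_refl _ _).mul_isLittleO (hf.trans_isBigO
      (IsBigO.of_bound 1 (Eventually.of_forall fun x => by simp)))
  have h2 : (fun x : ℝ => (x : ℂ) ^ p * ((x ^ r : ℝ) : ℂ)) =O[nhdsWithin 0 (Set.Ioi 0)]
      fun _ => (1 : ℝ) := by
    refine IsBigO.of_bound 1 ?_
    filter_upwards [Ioc_mem_nhdsGT (zero_lt_one' ℝ)] with x hx
    rw [norm_mul, Complex.norm_cpow_eq_rpow_re_of_pos hx.1, Complex.norm_real,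
      Real.norm_of_nonneg (Real.rpow_nonneg hx.1.le r), ← Real.rpow_add hx.1]
    simpa using Real.rpow_le_one hx.1.le hx.2 hp
  exact (isLittleO_one_iff ℝ).1 (h1.trans_isBigO h2)

lemma aux_cont (f : ℝ → ℂ) (X : ℝ) (hX : 0 < X) (c : ℂ)
    (hf : ContinuousOn f (Set.Icc 0 X)) (h0 : f 0 = c) :
    Tendsto f (nhdsWithin 0 (Set.Ioi 0)) (nhds c) := by
  have h := (hf 0 ⟨le_rfl, hX.le⟩).tendsto
  rw [h0] at h
  exact h.mono_left (nhdsWithin_le_of_mem (mem_of_superset (Ioc_mem_nhdsGT hX)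
    Set.Ioc_subset_Icc_self))

/-- Lemma 4: for the recursively defined functions
F_{k1} = U_{k0} − U⁰_{k0}, F_{k,s+1}(x,ρ) = (F_{ks}(x,ρ) − F_{ks}(0,ρ)Ŝ_s(x)c_{s0}⁻¹)x^{μ_s−μ_{s+1}},
the limits F_{ks}(0,ρ) := lim_{x→0+} F_{ks}(x,ρ) exist and equal
(b_{ks}(ρ)ρ^{−μ_1} − b⁰_{ks}ρ^{μ_s−μ_1})c_{s0}, and F_{ks} is given by the closed formula (26). -/
theorem stmt14 (n : ℕ) (hn : 2 ≤ n) (μ : Fin n → ℂ)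
    (hre : StrictMono fun j => (μ j).re)
    (ρ : ℂ) (hρ : ρ ≠ 0)
    (c0 : Fin n → ℂ) (hc0 : ∀ j, c0 j ≠ 0)
    (X : ℝ) (hX : 0 < X)
    (Sh Ch : Fin n → ℝ → ℂ)
    (hScont : ∀ j, ContinuousOn (Sh j) (Set.Icc 0 X))
    (hCcont : ∀ j, ContinuousOn (Ch j) (Set.Icc 0 X))
    (hS0 : ∀ j, Sh j 0 = c0 j) (hC0 : ∀ j, Ch j 0 = c0 j)
    (hlittle : ∀ j, (fun x : ℝ => Sh j x - Ch j x)
      =o[nhdsWithin 0 (Set.Ioi 0)]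
        fun x : ℝ => x ^ ((μ ⟨n - 1, by omega⟩ - μ ⟨0, by omega⟩).re))
    -- the coefficients b_{kj}(ρ) and b⁰_{kj} (for a fixed k)
    (b bb : Fin n → ℂ)
    (U U0 : ℝ → ℂ)
    (hU : ∀ x : ℝ, U x
      = ∑ j, b j * ρ ^ (-μ ⟨0, by omega⟩) * (x : ℂ) ^ (μ j - μ ⟨0, by omega⟩) * Sh j x)
    (hU0 : ∀ x : ℝ, U0 x
      = ∑ j, bb j * (ρ * (x : ℂ)) ^ (μ j - μ ⟨0, by omega⟩) * Ch j x) :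
    ∃ (Fk : Fin n → ℝ → ℂ) (L : Fin n → ℂ),
      -- F_{k1} = U_{k0} − U⁰_{k0}
      (∀ x ∈ Set.Ioc (0 : ℝ) X, Fk ⟨0, by omega⟩ x = U x - U0 x) ∧
      -- the recursion F_{k,s+1}(x) = (F_{ks}(x) − F_{ks}(0) Ŝ_s(x) c_{s0}⁻¹) x^{μ_s − μ_{s+1}}
      (∀ s : Fin n, ∀ h : (s : ℕ) + 1 < n, ∀ x ∈ Set.Ioc (0 : ℝ) X,
        Fk ⟨(s : ℕ) + 1, h⟩ x
          = (Fk s x - L s * Sh s x / c0 s) * (x : ℂ) ^ (μ s - μ ⟨(s : ℕ) + 1, h⟩)) ∧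
      -- the limits F_{ks}(0,ρ) exist …
      (∀ s : Fin n, Tendsto (Fk s) (nhdsWithin 0 (Set.Ioi 0)) (nhds (L s))) ∧
      -- … and equal (b_{ks}(ρ)ρ^{−μ_1} − b⁰_{ks}ρ^{μ_s−μ_1}) c_{s0}  (formula (25))
      (∀ s : Fin n,
        L s = (b s * ρ ^ (-μ ⟨0, by omega⟩)
                - bb s * ρ ^ (μ s - μ ⟨0, by omega⟩)) * c0 s) ∧
      -- the closed formula (26) on (0, X]
      (∀ s : Fin n, ∀ x ∈ Set.Ioc (0 : ℝ) X,
        Fk s x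
          = ((U x - U0 x)
              - ∑ j ∈ Finset.Iio s,
                  (b j * ρ ^ (-μ ⟨0, by omega⟩) - bb j * ρ ^ (μ j - μ ⟨0, by omega⟩))
                    * (x : ℂ) ^ (μ j - μ ⟨0, by omega⟩) * Sh j x)
            * (x : ℂ) ^ (μ ⟨0, by omega⟩ - μ s)) := by
  obtain ⟨z, hz⟩ : ∃ z : Fin n, z = ⟨0, by omega⟩ := ⟨_, rfl⟩
  obtain ⟨w, hw⟩ : ∃ w : Fin n, w = ⟨n - 1, by omega⟩ := ⟨_, rfl⟩
  simp only [← hz, ← hw] at hlittle hU hU0 ⊢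
  have hzle : ∀ j : Fin n, (μ z).re ≤ (μ j).re := fun j =>
    hre.monotone (by rw [hz, Fin.le_def]; simp)
  have hlew : ∀ j : Fin n, (μ j).re ≤ (μ w).re := fun j =>
    hre.monotone (by rw [hw, Fin.le_def]; simp only; omega)
  refine ⟨fun s x => ((U x - U0 x) - ∑ j ∈ Finset.Iio s,
      (b j * ρ ^ (-μ z) - bb j * ρ ^ (μ j - μ z)) * (x : ℂ) ^ (μ j - μ z) * Sh j x)
        * (x : ℂ) ^ (μ z - μ s),
    fun s => (b s * ρ ^ (-μ z) - bb s * ρ ^ (μ s - μ z)) * c0 s, ?_, ?_, ?_, fun _ => rfl,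
    fun _ _ _ => rfl⟩
  · intro x hx
    have : Finset.Iio z = ∅ := by
      ext j
      simp only [Finset.mem_Iio, Fin.lt_def, hz]
      simp
    simp [this]
  · intro s h x hx
    have hx' : (x : ℂ) ≠ 0 := by exact_mod_cast hx.1.ne'
    have hI : Finset.Iio (⟨(s : ℕ) + 1, h⟩ : Fin n) = insert s (Finset.Iio s) := by
      ext j
      simp only [Finset.mem_Iio, Finset.mem_insert, Fin.lt_def, Fin.ext_iff]
      omega
    simp only []
    rw [hI, Finset.sum_insert (by simp)]
    have e1 : (x : ℂ) ^ (μ z - μ ⟨(s : ℕ) + 1, h⟩)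
        = (x : ℂ) ^ (μ z - μ s) * (x : ℂ) ^ (μ s - μ ⟨(s : ℕ) + 1, h⟩) := by
      rw [← Complex.cpow_add _ _ hx']
      congr 1
      ring
    have e2 : (x : ℂ) ^ (μ s - μ z) * (x : ℂ) ^ (μ z - μ s) = 1 := by
      rw [← Complex.cpow_add _ _ hx']
      simp
    rw [e1, mul_right_comm _ (c0 s), mul_div_assoc, div_self (hc0 s), mul_one]
    linear_combination (-(b s * ρ ^ (-μ z) - bb s * ρ ^ (μ s - μ z)) * Sh s x
      * (x : ℂ) ^ (μ s - μ ⟨(s : ℕ) + 1, h⟩)) * e2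
  · intro s
    have key : ∀ x : ℝ, 0 < x →
        ∑ j, ((if j < s then 0 else (b j * ρ ^ (-μ z) - bb j * ρ ^ (μ j - μ z))
            * ((x : ℂ) ^ (μ j - μ s) * Sh j x))
          + bb j * ρ ^ (μ j - μ z) * ((x : ℂ) ^ (μ j - μ s) * (Sh j x - Ch j x)))
        = ((U x - U0 x) - ∑ j ∈ Finset.Iio s,
          (b j * ρ ^ (-μ z) - bb j * ρ ^ (μ j - μ z)) * (x : ℂ) ^ (μ j - μ z) * Sh j x)
        * (x : ℂ) ^ (μ z - μ s) := by
      intro x hx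
      have hx' : (x : ℂ) ≠ 0 := by exact_mod_cast hx.ne'
      have hI : Finset.Iio s = Finset.univ.filter (fun j => j < s) := by
        ext j
        simp
      rw [hU, hU0, hI, Finset.sum_filter, ← Finset.sum_sub_distrib, ← Finset.sum_sub_distrib,
        Finset.sum_mul]
      refine Finset.sum_congr rfl fun j _ => ?_
      have e1 : (x : ℂ) ^ (μ j - μ s) = (x : ℂ) ^ (μ j - μ z) * (x : ℂ) ^ (μ z - μ s) := by
        rw [← Complex.cpow_add _ _ hx']
        congr 1
        ring
      rw [aux_mul_cpow ρ hρ x hx, e1]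
      split_ifs <;> ring
    have lim : Tendsto (fun x : ℝ =>
        ∑ j, ((if j < s then 0 else (b j * ρ ^ (-μ z) - bb j * ρ ^ (μ j - μ z))
            * ((x : ℂ) ^ (μ j - μ s) * Sh j x))
          + bb j * ρ ^ (μ j - μ z) * ((x : ℂ) ^ (μ j - μ s) * (Sh j x - Ch j x))))
        (nhdsWithin 0 (Set.Ioi 0))
        (nhds (∑ j, ((if j = s then (b j * ρ ^ (-μ z) - bb j * ρ ^ (μ j - μ z)) * c0 j else 0)
          + bb j * ρ ^ (μ j - μ z) * 0))) := by
      refine tendsto_finsetSum _ fun j _ => ?_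
      refine Tendsto.add ?_ (Tendsto.const_mul _ (aux_little _ _ _ ?_ (hlittle j)))
      · rcases lt_trichotomy j s with hjs | hjs | hjs
        · simp [hjs, hjs.ne]
        · subst hjs
          simpa using Tendsto.const_mul (b j * ρ ^ (-μ z) - bb j * ρ ^ (μ j - μ z))
            (aux_cont _ X hX _ (hScont j) (hS0 j))
        · simp only [hjs.not_gt, hjs.ne', if_false]
          have hp : 0 < (μ j - μ s).re := by
            have : (μ s).re < (μ j).re := hre hjs
            simpa using this
          simpa using Tendsto.const_mul (b j * ρ ^ (-μ z) - bb j * ρ ^ (μ j - μ z))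
            ((aux_pow_zero _ hp).mul (aux_cont _ X hX _ (hScont j) (hS0 j)))
      · simp only [Complex.sub_re]
        linarith [hzle j, hlew s]
    have e : (∑ j, ((if j = s then (b j * ρ ^ (-μ z) - bb j * ρ ^ (μ j - μ z)) * c0 j else 0)
          + bb j * ρ ^ (μ j - μ z) * 0))
        = (b s * ρ ^ (-μ z) - bb s * ρ ^ (μ s - μ z)) * c0 s := by
      simp
    rw [e] at lim
    refine lim.congr' ?_
    filter_upwards [self_mem_nhdsWithin] with x hx
    exact key x hx
end
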